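/- BK Fixpoint Lemma (set version): Let U_a and U_b be sets with relations R_a ⊆ U_a × U_b and R_b ⊆ U_b × U_a, and suppose that for every predicate p on U_a there exists x0 ∈ U_a satisfying the BK assumptions for (p, x0). Then every unary propositional operator O : Prop → Prop has a fixpoint, i.e. there exists a proposition s with O(s) ↔ s. -/

import Mathlib

/-- BK Fixpoint Lemma (set version): if for every predicate `p` on `Ua` there is a
point `x0` satisfying the BK assumptions for `(p, x0)`, then every unary propositional
operator `O : Prop → Prop` has a fixpoint. -/
theorem bk_fixpoint_lemma {Ua Ub : Type*} (Ra : Ua → Ub → Prop) (Rb : Ub → Ua → Prop)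
    (H : ∀ p : Ua → Prop, ∃ x0 : Ua,
      (∀ y : Ub, Ra x0 y → ∀ x : Ua, Rb y x ↔ p x) ∧ (∃ y : Ub, Ra x0 y)) :
    ∀ O : Prop → Prop, ∃ s : Prop, O s ↔ s := by
  intro O
  obtain ⟨x0, h, y, hy⟩ := H fun x => O (∃ y, Ra x y ∧ Rb y x)
  refine ⟨∃ y, Ra x0 y ∧ Rb y x0, fun hO => ⟨y, hy, (h y hy x0).2 hO⟩, ?_⟩
  rintro ⟨z, hz, hzx⟩
  exact (h z hz x0).1 hzx
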